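/- DCF₀ has the boundary property B(3): for every set A and any A-independent set {a₀, a₁, a₂} in a monster model of DCF₀, dcl(acl(Aa₀a₂) ∪ acl(Aa₁a₂)) ∩ acl(Aa₀a₁) = dcl(acl(Aa₀) ∪ acl(Aa₁)). -/

import Mathlib

open Polynomial

namespace PaperDCF

variable (Ω : Type) [Field Ω]

/-- The differential subfield of `Ω` generated by `S` (the `dcl` of `S` in `DCF₀`). -/
def ddcl (D : Ω → Ω) (S : Set Ω) : Subfield Ω :=
  sInf {K : Subfield Ω | S ⊆ K ∧ ∀ x ∈ K, D x ∈ K}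

/-- The algebraic closure (inside `Ω`) of the differential field generated by `S`
(the `acl` of `S` in `DCF₀`). -/
def aclD (D : Ω → Ω) (S : Set Ω) : Set Ω :=
  {x | ∃ p : Polynomial Ω, p ≠ 0 ∧ (∀ n, p.coeff n ∈ ddcl Ω D S) ∧ p.eval x = 0}

/-- A finite family `v` from `Ω` is linearly independent over the subset `E`. -/
def LinIndepOver (E : Set Ω) {n : ℕ} (v : Fin n → Ω) : Prop :=
  ∀ c : Fin n → Ω, (∀ i, c i ∈ E) → (∑ i, c i * v i = 0) → ∀ i, c i = 0

/-- `K` is linearly disjoint from `K'` over `E`: every finite family from `K` linearly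
independent over `E` stays linearly independent over `K'`. (This is the `ACF₀`
nonforking independence of the algebraically closed sets involved.) -/
def LinDisjOver (E K K' : Set Ω) : Prop :=
  ∀ (n : ℕ) (v : Fin n → Ω), (∀ i, v i ∈ K) → LinIndepOver Ω E v → LinIndepOver Ω K' v

end PaperDCF


open scoped TensorProduct

/-- Weak Nullstellensatz: a nonzero algebra of finite type over an algebraically closed field has
a rational point. -/
theorem IsAlgClosed.nonempty_algHom_of_finiteType (E R : Type*) [Field E] [IsAlgClosed E]
    [CommRing R] [Nontrivial R] [Algebra E R] [Algebra.FiniteType E R] :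
    Nonempty (R →ₐ[E] E) := by
  obtain ⟨m, hm⟩ := Ideal.exists_maximal R
  let := Ideal.Quotient.field m
  have := finite_of_finite_type_of_isJacobsonRing E (R ⧸ m)
  let e := AlgEquiv.ofBijective (Algebra.ofId E (R ⧸ m))
    IsAlgClosed.algebraMap_bijective_of_isIntegral
  exact ⟨e.symm.toAlgHom.comp (Ideal.Quotient.mkₐ E m)⟩

/-- A ring homomorphism from a subring to a nontrivial ring is dominated by a place: there is a valuation
subring containing the subring whose maximal ideal contains the kernel. -/
theorem ValuationSubring.exists_ker_subset_nonunits {Ω B C : Type*} [Field Ω] [CommRing B]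
    [CommRing C] [Nontrivial C] (τ : B →+* Ω) (hτ : Function.Injective τ) (Φ : B →+* C) :
    ∃ V : ValuationSubring Ω, (∀ b, τ b ∈ V) ∧ ∀ b, Φ b = 0 → V.valuation (τ b) < 1 := by
  let e : B ≃+* τ.range := RingEquiv.ofBijective τ.rangeRestrict
    ⟨fun _ _ h => hτ (congrArg Subtype.val h), τ.rangeRestrict_surjective⟩
  obtain ⟨V, hV, hI⟩ := Ideal.image_subset_nonunits_valuationSubring
    (RingHom.ker (Φ.comp e.symm.toRingHom)) (RingHom.ker_ne_top _)
  refine ⟨V, fun b => hV ⟨b, rfl⟩, fun b hb => hI ⟨e b, ?_, rfl⟩⟩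
  simpa [RingHom.mem_ker] using hb

/-- If `K` and `L` are linearly disjoint over an algebraically closed field `E`, then a nonzero
element of the ring `K[L]` is a unit at some place which is trivial on `K` and sends given
elements of `L` into `E`. -/
theorem ValuationSubring.exists_specialization {E K L Ω : Type*} [Field E] [IsAlgClosed E]
    [Field K] [Field L] [Field Ω] [Algebra E K] [Algebra E L] [Algebra E Ω]
    (f : K →ₐ[E] Ω) (g : L →ₐ[E] Ω)
    (hfg : Function.Injective (Algebra.TensorProduct.productMap f g))
    (S : Finset L) (t : K ⊗[E] L) (ht : t ≠ 0) :
    ∃ V : ValuationSubring Ω, (∀ k, f k ∈ V) ∧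
      (∀ s ∈ S, ∃ e : E, V.valuation (g s - algebraMap E Ω e) < 1) ∧
      (Algebra.TensorProduct.productMap f g t)⁻¹ ∈ V := by
  classical
  let b := Module.Basis.ofVectorSpace E K
  set c := TensorProduct.equivFinsuppOfBasisLeft (N := L) b t with hc
  have htc : t = c.sum fun i l => b i ⊗ₜ[E] l := by
    rw [← TensorProduct.equivFinsuppOfBasisLeft_symm_apply, hc, LinearEquiv.symm_apply_apply]
  obtain ⟨i₀, hi₀⟩ : ∃ i, c i ≠ 0 := by
    by_contra! h
    exact ht (by simpa [hc] using (Finsupp.ext h : c = 0))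
  let R : Subalgebra E L := Algebra.adjoin E ↑(S ∪ c.support.image c ∪ {(c i₀)⁻¹})
  have hS : ∀ s ∈ S, s ∈ R := fun s hs => Algebra.subset_adjoin (by simp [hs])
  have hcR : ∀ i, c i ∈ R := fun i => by
    by_cases hi : c i = 0
    · rw [hi]; exact R.zero_mem
    · exact Algebra.subset_adjoin (by
        simp only [Finset.coe_union, Finset.coe_image, Set.mem_union, Set.mem_image]
        exact Or.inl (Or.inr ⟨i, by simpa using hi, rfl⟩))
  have hinv : (c i₀)⁻¹ ∈ R := Algebra.subset_adjoin (by simp)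
  have : Algebra.FiniteType E R := R.fg_iff_finiteType.mp (Subalgebra.fg_adjoin_finset _)
  obtain ⟨ψ⟩ := IsAlgClosed.nonempty_algHom_of_finiteType E R
  let ι : K ⊗[E] R →ₐ[E] K ⊗[E] L := Algebra.TensorProduct.map (AlgHom.id E K) R.val
  have hι : Function.Injective ι :=
    Module.Flat.lTensor_preserves_injective_linearMap R.val.toLinearMap Subtype.val_injective
  let τ : K ⊗[E] R →ₐ[E] Ω := (Algebra.TensorProduct.productMap f g).comp ι
  let Φ : K ⊗[E] R →ₐ[E] K :=
    Algebra.TensorProduct.productMap (AlgHom.id E K) ((Algebra.ofId E K).comp ψ)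
  have hτ : ∀ k r, τ (k ⊗ₜ r) = f k * g r := fun k r => by simp [τ, ι]
  have hΦ : ∀ k r, Φ (k ⊗ₜ r) = k * algebraMap E K (ψ r) := fun k r => by
    simp [Φ, Algebra.ofId_apply]
  obtain ⟨V, hV, hker⟩ := ValuationSubring.exists_ker_subset_nonunits
    τ.toRingHom (hfg.comp hι) Φ.toRingHom
  have hK : ∀ k, f k ∈ V := fun k => by simpa [hτ] using hV (k ⊗ₜ 1)
  refine ⟨V, hK, fun s hs => ⟨ψ ⟨s, hS s hs⟩, ?_⟩, ?_⟩
  · have := hker (1 ⊗ₜ ⟨s, hS s hs⟩ - algebraMap E K (ψ ⟨s, hS s hs⟩) ⊗ₜ 1) (by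
      simp [hΦ])
    simpa [hτ] using this
  · let t' : K ⊗[E] R := ∑ i ∈ c.support, b i ⊗ₜ[E] (⟨c i, hcR i⟩ : R)
    have ht' : ι t' = t := by simp [t', ι, map_sum, htc, Finsupp.sum]
    have hψ : ψ ⟨c i₀, hcR i₀⟩ ≠ 0 := fun h => by
      have h1 : (⟨c i₀, hcR i₀⟩ : R) * ⟨_, hinv⟩ = 1 := Subtype.ext (mul_inv_cancel₀ hi₀)
      have h2 := congrArg ψ h1
      rw [map_mul, h, zero_mul, map_one] at h2
      exact zero_ne_one h2
    have hΦt : Φ t' ≠ 0 := fun h => by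
      have h1 : ∑ i ∈ c.support, ψ ⟨c i, hcR i⟩ • b i = 0 := by
        rw [← h]; simp [t', map_sum, hΦ, Algebra.smul_def, mul_comm]
      exact hψ (linearIndependent_iff'.mp b.linearIndependent _ _ h1 i₀ (by simpa using hi₀))
    have hlt := hker (t' - Φ t' ⊗ₜ 1) (by simp [hΦ])
    have hval : V.valuation (f (Φ t')) = 1 := by
      refine le_antisymm ((V.valuation_le_one_iff _).2 (hK _)) ?_
      have := (V.valuation_le_one_iff _).2 (hK (Φ t')⁻¹)
      rw [map_inv₀, map_inv₀] at this
      exact (inv_le_one₀ (by simpa [zero_lt_iff] using hΦt)).1 this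
    have hlt' : V.valuation (τ t' - f (Φ t')) < V.valuation (f (Φ t')) := by
      rw [hval]; simpa [hτ] using hlt
    have h1 : V.valuation (τ t') = 1 := (Valuation.map_eq_of_sub_lt _ hlt').trans hval
    have h2 : τ t' = Algebra.TensorProduct.productMap f g t := by
      rw [← ht']; rfl
    rw [← V.valuation_le_one_iff, map_inv₀, ← h2, h1, inv_one]

/-- A valuation subring contains every root of a monic polynomial with coefficients in it. -/
theorem ValuationSubring.mem_of_monic_root {Ω : Type*} [Field Ω] (V : ValuationSubring Ω)
    {p : Polynomial Ω} (hp : p.Monic) (hc : ∀ n, p.coeff n ∈ V) {y : Ω} (hy : p.eval y = 0) : y ∈ V := by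
  have hsub : (p.coeffs : Set Ω) ⊆ V.toSubring := fun c hmem => by
    obtain ⟨n, -, rfl⟩ := Polynomial.mem_coeffs_iff.mp hmem
    exact hc n
  have hint : IsIntegral V y := ⟨p.toSubring V.toSubring hsub,
    (p.monic_toSubring V.toSubring hsub).mpr hp, by
      rw [Polynomial.eval₂_eq_eval_map]
      exact (congrArg (Polynomial.eval y) (p.map_toSubring V.toSubring hsub)).trans hy⟩
  obtain ⟨z, rfl⟩ := IsIntegrallyClosed.isIntegral_iff.mp hint
  exact z.2

theorem Subfield.isIntegral_mono {Ω : Type*} [Field Ω] {A B : Subfield Ω} (h : A ≤ B) {x : Ω}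
    (hx : IsIntegral A x) : IsIntegral B x :=
  hx.map_of_comp_eq (Subfield.inclusion h) (RingHom.id Ω) rfl

/-- An element integral over a subfield is a root of a monic polynomial with coefficients in it. -/
theorem Subfield.exists_monic_of_isIntegral {Ω : Type*} [Field Ω] {A : Subfield Ω} {x : Ω}
    (hx : IsIntegral A x) :
    ∃ p : Polynomial Ω, p.Monic ∧ (∀ n, p.coeff n ∈ A) ∧ p.eval x = 0 := by
  obtain ⟨p, hp, hx⟩ := hx
  refine ⟨p.map A.subtype, hp.map _, fun n => by simp, ?_⟩
  rwa [Polynomial.eval₂_eq_eval_map] at hx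

section GenericPlaces

variable {E Ω : Type*} [Field E] [Field Ω] [Algebra E Ω] (K L : IntermediateField E Ω)

/-- The places of `Ω` that are finite on `K` and send every element of `S` into `E`. -/
def specializingPlaces (S : Finset L) : Set (ValuationSubring Ω) :=
  {V | (∀ k ∈ K, k ∈ V) ∧ ∀ s ∈ S, ∃ e : E, V.valuation ((s : Ω) - algebraMap E Ω e) < 1}

variable {K L}

theorem specializingPlaces_anti {S T : Finset L} (h : S ⊆ T) :
    specializingPlaces K L T ⊆ specializingPlaces K L S :=
  fun _ hV => ⟨hV.1, fun s hs => hV.2 s (h hs)⟩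

theorem mem_of_valuation_sub_algebraMap_lt_one {V : ValuationSubring Ω}
    (hK : ∀ k ∈ K, k ∈ V) {x : Ω} {e : E} (h : V.valuation (x - algebraMap E Ω e) < 1) : x ∈ V := by
  rw [← sub_add_cancel x (algebraMap E Ω e)]
  exact V.add_mem _ _ ((V.valuation_le_one_iff _).1 h.le) (hK _ (K.algebraMap_mem e))

theorem exists_productMap_mem (t : K ⊗[E] L) :
    ∃ S : Finset L, ∀ V ∈ specializingPlaces K L S,
      Algebra.TensorProduct.productMap K.val L.val t ∈ V := by
  classical
  induction t with
  | zero => exact ⟨∅, fun V _ => by rw [map_zero]; exact V.zero_mem⟩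
  | tmul k l =>
    refine ⟨{l}, fun V hV => ?_⟩
    obtain ⟨e, he⟩ := hV.2 l (by simp)
    simpa using V.mul_mem _ _ (hV.1 k k.2) (mem_of_valuation_sub_algebraMap_lt_one hV.1 he)
  | add x y hx hy =>
    obtain ⟨S, hS⟩ := hx
    obtain ⟨T, hT⟩ := hy
    refine ⟨S ∪ T, fun V hV => ?_⟩
    rw [map_add]
    exact V.add_mem _ _ (hS V (specializingPlaces_anti Finset.subset_union_left hV))
      (hT V (specializingPlaces_anti Finset.subset_union_right hV))

/-- If `K` and `L` are linearly disjoint over an algebraically closed field `E`, there is a proper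
filter of places, trivial on `K`, along which every element of `L` eventually specializes into `E`
and every element algebraic over the compositum of `K` and `L` is eventually finite. -/
theorem exists_filter_specializing [IsAlgClosed E]
    (hKL : Function.Injective (Algebra.TensorProduct.productMap K.val L.val)) :
    ∃ 𝓕 : Filter (ValuationSubring Ω), 𝓕.NeBot ∧ (∀ᶠ V in 𝓕, ∀ k ∈ K, k ∈ V) ∧
      (∀ l ∈ L, ∀ᶠ V in 𝓕, ∃ e : E, V.valuation (l - algebraMap E Ω e) < 1) ∧
      ∀ y, IsIntegral (K ⊔ L).toSubfield y → ∀ᶠ V in 𝓕, y ∈ V := by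
  classical
  let π := Algebra.TensorProduct.productMap K.val L.val
  let I := {i : Finset L × (K ⊗[E] L) // i.2 ≠ 0 ∧ ∀ V ∈ specializingPlaces K L i.1, π i.2 ∈ V}
  let B : I → Set (ValuationSubring Ω) := fun i =>
    specializingPlaces K L i.1.1 ∩ {V | (π i.1.2)⁻¹ ∈ V}
  let 𝓕 : Filter (ValuationSubring Ω) := ⨅ i, Filter.principal (B i)
  have hB : ∀ i, B i ∈ 𝓕 := fun i =>
    Filter.mem_iInf_of_mem i (Filter.mem_principal_self _)
  have hπ : ∀ t, t ≠ 0 → π t ≠ 0 := fun t ht h => ht (hKL (h.trans (map_zero π).symm))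
  let ofFinset : Finset L → I := fun S =>
    ⟨(S, 1), one_ne_zero, fun V _ => by rw [map_one]; exact V.one_mem⟩
  have : Nonempty I := ⟨ofFinset ∅⟩
  have hdir : Directed (· ≥ ·) fun i => Filter.principal (B i) := by
    rintro ⟨⟨S, s⟩, hs, hS⟩ ⟨⟨T, t⟩, ht, hT⟩
    have hST := specializingPlaces_anti (K := K) (Finset.subset_union_left (s₁ := S) (s₂ := T))
    have hTS := specializingPlaces_anti (K := K) (Finset.subset_union_right (s₁ := S) (s₂ := T))
    refine ⟨⟨(S ∪ T, s * t), fun h => ?_, fun V hV => ?_⟩, ?_, ?_⟩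
    · exact mul_ne_zero (hπ s hs) (hπ t ht) ((map_mul π s t).symm.trans ((congrArg π h).trans (map_zero π)))
    · rw [map_mul]
      exact V.mul_mem _ _ (hS V (hST hV)) (hT V (hTS hV))
    · refine Filter.principal_mono.mpr fun V hV => ⟨hST hV.1, ?_⟩
      have := V.mul_mem _ _ hV.2 (hT V (hTS hV.1))
      simpa [mul_assoc, mul_comm, hπ t ht] using this
    · refine Filter.principal_mono.mpr fun V hV => ⟨hTS hV.1, ?_⟩
      have := V.mul_mem _ _ hV.2 (hS V (hST hV.1))
      simpa [mul_assoc, mul_comm, hπ s hs] using this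
  have hmem : ∀ t, ∀ᶠ V in 𝓕, π t ∈ V := fun t => by
    obtain ⟨S, hS⟩ := exists_productMap_mem t
    filter_upwards [hB (ofFinset S)] with V hV using hS V hV.1
  have hinv : ∀ t, ∀ᶠ V in 𝓕, (π t)⁻¹ ∈ V := fun t => by
    by_cases ht : t = 0
    · exact .of_forall fun V => by rw [ht, map_zero, inv_zero]; exact V.zero_mem
    · obtain ⟨S, hS⟩ := exists_productMap_mem t
      filter_upwards [hB ⟨(S, t), ht, hS⟩] with V hV using hV.2
  refine ⟨𝓕, Filter.iInf_neBot_of_directed' hdir fun i => ?_, ?_, fun l hl => ?_, fun y hy => ?_⟩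
  · obtain ⟨V, hK, hS, hV⟩ := ValuationSubring.exists_specialization K.val L.val hKL
      i.1.1 i.1.2 i.2.1
    exact Filter.principal_neBot_iff.mpr ⟨V, ⟨fun k hk => hK ⟨k, hk⟩, hS⟩, hV⟩
  · filter_upwards [hB (ofFinset ∅)] with V hV using hV.1.1
  · filter_upwards [hB (ofFinset {⟨l, hl⟩})] with V hV using hV.1.2 ⟨l, hl⟩ (by simp [ofFinset])
  · obtain ⟨p, hp, hc, hy⟩ := Subfield.exists_monic_of_isIntegral hy
    have hcV : ∀ n, ∀ᶠ V in 𝓕, p.coeff n ∈ V := fun n => by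
      have hn : p.coeff n ∈ K ⊔ L := hc n
      rw [IntermediateField.sup_def, IntermediateField.mem_adjoin_iff_div] at hn
      obtain ⟨r, hr, s, hs, hrs⟩ := hn
      have hrange : Algebra.adjoin E ((K : Set Ω) ∪ L) ≤ π.range := by
        refine Algebra.adjoin_le ?_
        rintro x (hx | hx)
        · exact ⟨⟨x, hx⟩ ⊗ₜ 1, by simp [π]⟩
        · exact ⟨1 ⊗ₜ ⟨x, hx⟩, by simp [π]⟩
      obtain ⟨t, rfl⟩ := hrange hr
      obtain ⟨u, rfl⟩ := hrange hs
      filter_upwards [hmem t, hinv u] with V ht hu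
      rw [hrs, div_eq_mul_inv]
      exact V.mul_mem _ _ ht hu
    have hall : ∀ᶠ V in 𝓕, ∀ n ∈ Finset.range (p.natDegree + 1), p.coeff n ∈ V :=
      (Filter.eventually_all_finset _).mpr fun n _ => hcV n
    filter_upwards [hall] with V hV
    refine V.mem_of_monic_root hp (fun n => ?_) hy
    by_cases hn : n ∈ Finset.range (p.natDegree + 1)
    · exact hV n hn
    · rw [Polynomial.coeff_eq_zero_of_natDegree_lt (by simpa using hn)]
      exact V.zero_mem

end GenericPlaces

section ResidueSubfield

variable {Ω : Type*} [Field Ω] {𝓕 : Filter (ValuationSubring Ω)} {K M : Subfield Ω}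

/-- The elements of `M` whose residue along the filter `𝓕` of places eventually lies in the
subfield `F` of the residue fields. -/
def residueSubfield (hK : ∀ᶠ V in 𝓕, ∀ k ∈ K, k ∈ V) (hM : ∀ y ∈ M, ∀ᶠ V in 𝓕, y ∈ V)
    (F : Subfield Ω) (hF : F ≤ K) : Subfield Ω where
  carrier := {y | y ∈ M ∧ ∀ᶠ V in 𝓕, ∃ k ∈ F, V.valuation (y - k) < 1}
  zero_mem' := ⟨M.zero_mem, .of_forall fun V => ⟨0, F.zero_mem, by simp⟩⟩
  one_mem' := ⟨M.one_mem, .of_forall fun V => ⟨1, F.one_mem, by simp⟩⟩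
  neg_mem' := by
    rintro x ⟨hxM, hx⟩
    refine ⟨M.neg_mem hxM, hx.mono ?_⟩
    rintro V ⟨k, hk, h⟩
    refine ⟨-k, F.neg_mem hk, ?_⟩
    rwa [neg_sub_neg, Valuation.map_sub_swap]
  add_mem' := by
    rintro x y ⟨hxM, hx⟩ ⟨hyM, hy⟩
    refine ⟨M.add_mem hxM hyM, ?_⟩
    filter_upwards [hx, hy]
    rintro V ⟨k, hk, h⟩ ⟨l, hl, h'⟩
    refine ⟨k + l, F.add_mem hk hl, ?_⟩
    rw [add_sub_add_comm]
    exact Valuation.map_add_lt _ h h'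
  mul_mem' := by
    rintro x y ⟨hxM, hx⟩ ⟨hyM, hy⟩
    refine ⟨M.mul_mem hxM hyM, ?_⟩
    filter_upwards [hx, hy, hM x hxM, hK]
    rintro V ⟨k, hk, h⟩ ⟨l, hl, h'⟩ hxV hKV
    refine ⟨k * l, F.mul_mem hk hl, ?_⟩
    rw [show x * y - k * l = x * (y - l) + (x - k) * l by ring]
    refine Valuation.map_add_lt _ ?_ ?_ <;> rw [map_mul]
    · rw [mul_comm]
      exact mul_lt_one_of_lt_of_le h' ((V.valuation_le_one_iff _).2 hxV)
    · exact mul_lt_one_of_lt_of_le h ((V.valuation_le_one_iff _).2 (hKV l (hF hl)))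
  inv_mem' := by
    rintro x ⟨hxM, hx⟩
    by_cases hx0 : x = 0
    · subst hx0
      exact ⟨by simp, .of_forall fun V => ⟨0, F.zero_mem, by simp⟩⟩
    refine ⟨M.inv_mem hxM, ?_⟩
    filter_upwards [hx, hM _ (M.inv_mem hxM), hK]
    rintro V ⟨k, hk, h⟩ hxV hKV
    have hxV' := (V.valuation_le_one_iff _).2 hxV
    have hk0 : k ≠ 0 := by
      rintro rfl
      have := mul_lt_one_of_lt_of_le h hxV'
      rw [sub_zero, ← map_mul, mul_inv_cancel₀ hx0, map_one] at this
      exact this.false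
    refine ⟨k⁻¹, F.inv_mem hk, ?_⟩
    rw [show x⁻¹ - k⁻¹ = -((x - k) * (x⁻¹ * k⁻¹)) by field_simp; ring, Valuation.map_neg, map_mul]
    exact mul_lt_one_of_lt_of_le h
      ((V.valuation_le_one_iff _).2 (V.mul_mem _ _ hxV (hKV _ (hF (F.inv_mem hk)))))

variable {hK : ∀ᶠ V in 𝓕, ∀ k ∈ K, k ∈ V} {hM : ∀ y ∈ M, ∀ᶠ V in 𝓕, y ∈ V}

theorem residueSubfield_mono {F G : Subfield Ω} (hF : F ≤ K) (hG : G ≤ K) (h : F ≤ G) :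
    residueSubfield hK hM F hF ≤ residueSubfield hK hM G hG :=
  fun _ hx => ⟨hx.1, hx.2.mono fun _ ⟨k, hk, hlt⟩ => ⟨k, h hk, hlt⟩⟩

theorem le_residueSubfield {F : Subfield Ω} (hF : F ≤ K) (hFM : F ≤ M) :
    F ≤ residueSubfield hK hM F hF :=
  fun x hx => ⟨hFM hx, .of_forall fun V => ⟨x, hx, by simp⟩⟩

theorem mem_of_mem_residueSubfield [𝓕.NeBot] {F : Subfield Ω} (hF : F ≤ K) {x : Ω}
    (hxK : x ∈ K) (hx : x ∈ residueSubfield hK hM F hF) : x ∈ F := by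
  obtain ⟨V, ⟨k, hk, h⟩, hKV⟩ := (hx.2.and hK).exists
  by_cases hxk : x - k = 0
  · rwa [sub_eq_zero.mp hxk]
  have := mul_lt_one_of_lt_of_le h ((V.valuation_le_one_iff _).2
    (hKV _ (K.inv_mem (K.sub_mem hxK (hF hk)))))
  rw [← map_mul, mul_inv_cancel₀ hxk, map_one] at this
  exact this.false.elim

/-- If `F` is algebraically closed, then the elements of `M` with residues in `F` form a
relatively algebraically closed subfield of `M`. -/
theorem mem_residueSubfield_of_isIntegral {F : Subfield Ω} [IsAlgClosed F] (hF : F ≤ K) {x : Ω}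
    (hxM : x ∈ M) (hx : IsIntegral (residueSubfield hK hM F hF) x) :
    x ∈ residueSubfield hK hM F hF := by
  obtain ⟨p, hp, hc, hx⟩ := Subfield.exists_monic_of_isIntegral hx
  have hall : ∀ᶠ V in 𝓕, ∀ n ∈ Finset.range p.natDegree,
      ∃ k ∈ F, V.valuation (p.coeff n - k) < 1 :=
    (Filter.eventually_all_finset _).mpr fun n _ => (hc n).2
  refine ⟨hxM, ?_⟩
  filter_upwards [hall, hM x hxM] with V hV hxV
  choose! k hk hlt using hV
  let q : Polynomial F := X ^ p.natDegree + ∑ n : Fin p.natDegree,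
    C (⟨k n, hk n (Finset.mem_range.mpr n.2)⟩ : F) * X ^ (n : ℕ)
  have hq : q.Monic := Polynomial.monic_X_pow_add (Polynomial.degree_sum_fin_lt _)
  have hqx : V.valuation (q.eval₂ F.subtype x) < 1 := by
    have heq : q.eval₂ F.subtype x =
        ∑ n : Fin p.natDegree, (k n - p.coeff n) * x ^ (n : ℕ) := by
      rw [hp.as_sum] at hx
      simp only [Polynomial.eval_add, Polynomial.eval_pow, Polynomial.eval_X,
        Polynomial.eval_finsetSum, Polynomial.eval_mul, Polynomial.eval_C,
        Finset.sum_range] at hx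
      simp only [q, Polynomial.eval₂_add, Polynomial.eval₂_X_pow, Polynomial.eval₂_finsetSum,
        Polynomial.eval₂_mul, Polynomial.eval₂_C, Subfield.subtype_apply, sub_mul,
        Finset.sum_sub_distrib]
      linear_combination hx
    rw [heq]
    refine Valuation.map_sum_lt _ one_ne_zero fun n _ => ?_
    rw [map_mul, Valuation.map_sub_swap]
    exact mul_lt_one_of_lt_of_le (hlt n (Finset.mem_range.mpr n.2))
      ((V.valuation_le_one_iff _).2 (pow_mem hxV _))
  by_contra! hne
  refine hqx.not_ge ?_
  rw [(IsAlgClosed.splits q).eq_prod_roots_of_monic hq]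
  induction q.roots using Multiset.induction with
  | empty => simp
  | cons a s ih =>
    rw [Multiset.map_cons, Multiset.prod_cons, Polynomial.eval₂_mul, map_mul]
    refine one_le_mul (by simpa using hne a a.2) ih

end ResidueSubfield

/-- Boundary property `B(3)` for algebraically closed fields: if `L` is linearly disjoint from `K`
over an algebraically closed field `E`, and `K₀`, `K₁` are algebraically closed subfields of `K`,
then a member of `K` in the compositum of extensions algebraic over `K₀ L` and `K₁ L` already lies
in `K₀ K₁`. -/
theorem mem_sup_of_mem_sup_of_linearDisjoint {E Ω : Type*} [Field E] [IsAlgClosed E] [Field Ω]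
    [Algebra E Ω] {K L K₀ K₁ : IntermediateField E Ω} [IsAlgClosed K₀.toSubfield]
    [IsAlgClosed K₁.toSubfield] (h₀ : K₀ ≤ K) (h₁ : K₁ ≤ K)
    (hKL : Function.Injective (Algebra.TensorProduct.productMap K.val L.val))
    {C₀ C₁ : Subfield Ω} (hC₀ : ∀ x ∈ C₀, IsIntegral ↥(K₀.toSubfield ⊔ L.toSubfield) x)
    (hC₁ : ∀ x ∈ C₁, IsIntegral ↥(K₁.toSubfield ⊔ L.toSubfield) x) {x : Ω}
    (hx : x ∈ C₀ ⊔ C₁) (hxK : x ∈ K) : x ∈ K₀.toSubfield ⊔ K₁.toSubfield := by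
  obtain ⟨𝓕, _, hK, hL, hM⟩ := exists_filter_specializing hKL
  let M : Subfield Ω := (algebraicClosure (K ⊔ L).toSubfield Ω).toSubfield
  have hM' : ∀ y ∈ M, ∀ᶠ V in 𝓕, y ∈ V := fun y hy => hM y hy
  have hK' : ∀ᶠ V in 𝓕, ∀ k ∈ K.toSubfield, k ∈ V := hK
  have hle : (K ⊔ L).toSubfield ≤ M := fun y hy =>
    (algebraicClosure (K ⊔ L).toSubfield Ω).algebraMap_mem ⟨y, hy⟩
  have hKM : K ≤ K ⊔ L := le_sup_left
  have hLM : L ≤ K ⊔ L := le_sup_right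
  have key : ∀ (F : IntermediateField E Ω) (hF : F ≤ K) [IsAlgClosed F.toSubfield] (C : Subfield Ω),
      (∀ y ∈ C, IsIntegral ↥(F.toSubfield ⊔ L.toSubfield) y) →
      C ≤ residueSubfield hK' hM' F.toSubfield hF := by
    intro F hF _ C hC y hy
    have hFL : F.toSubfield ⊔ L.toSubfield ≤ residueSubfield hK' hM' F.toSubfield hF := by
      refine sup_le (le_residueSubfield _ fun z hz => hle (hKM (hF hz))) fun l hl =>
        ⟨hle (hLM hl), ?_⟩
      filter_upwards [hL l hl]
      rintro V ⟨e, he⟩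
      exact ⟨_, F.algebraMap_mem e, he⟩
    refine mem_residueSubfield_of_isIntegral _ ?_ (Subfield.isIntegral_mono hFL (hC y hy))
    exact Subfield.isIntegral_mono (B := (K ⊔ L).toSubfield)
      (sup_le (fun z hz => hKM (hF hz)) hLM) (hC y hy)
  have hsup : K₀.toSubfield ⊔ K₁.toSubfield ≤ K.toSubfield := sup_le h₀ h₁
  refine mem_of_mem_residueSubfield (hK := hK') (hM := hM') hsup hxK ?_
  exact sup_le ((key K₀ h₀ C₀ hC₀).trans (residueSubfield_mono _ _ le_sup_left))
    ((key K₁ h₁ C₁ hC₁).trans (residueSubfield_mono _ _ le_sup_right)) hx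

namespace PaperDCF

variable {Ω : Type} [Field Ω]

theorem subset_ddcl (D : Ω → Ω) (S : Set Ω) : S ⊆ ddcl Ω D S := fun _ hx =>
  Subfield.mem_sInf.mpr fun _ hK => hK.1 hx

theorem apply_mem_ddcl (D : Ω → Ω) (S : Set Ω) : ∀ x ∈ ddcl Ω D S, D x ∈ ddcl Ω D S :=
  fun x hx => Subfield.mem_sInf.mpr fun K hK => hK.2 x (Subfield.mem_sInf.mp hx K hK)

theorem ddcl_le {D : Ω → Ω} {S : Set Ω} {K : Subfield Ω} (hS : S ⊆ K) (hD : ∀ x ∈ K, D x ∈ K) :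
    ddcl Ω D S ≤ K :=
  sInf_le ⟨hS, hD⟩

theorem ddcl_mono {D : Ω → Ω} {S T : Set Ω} (h : S ⊆ T) : ddcl Ω D S ≤ ddcl Ω D T :=
  ddcl_le (h.trans (subset_ddcl D T)) (apply_mem_ddcl D T)

/-- The set `aclD Ω D S`, as a subfield. -/
def aclField (D : Ω → Ω) (S : Set Ω) : Subfield Ω :=
  (algebraicClosure (ddcl Ω D S) Ω).toSubfield

theorem coe_aclField (D : Ω → Ω) (S : Set Ω) : (aclField D S : Set Ω) = aclD Ω D S := by
  ext x
  constructor
  · intro hx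
    obtain ⟨p, hp, hc, hx⟩ := Subfield.exists_monic_of_isIntegral hx
    exact ⟨p, hp.ne_zero, hc, hx⟩
  · rintro ⟨p, hp, hc, hx⟩
    have hlift : p ∈ Polynomial.lifts (ddcl Ω D S).subtype :=
      (Polynomial.lifts_iff_coeff_lifts p).mpr fun n => ⟨⟨_, hc n⟩, rfl⟩
    obtain ⟨q, rfl⟩ := (Polynomial.mem_lifts p).mp hlift
    refine IsAlgebraic.isIntegral ⟨q, fun h => hp (by simp [h]), ?_⟩
    rwa [Polynomial.eval_map] at hx

instance [IsAlgClosed Ω] (D : Ω → Ω) (S : Set Ω) : IsAlgClosed (aclField D S) :=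
  (algebraicClosure.isAlgClosure (F := ddcl Ω D S) (E := Ω)).isAlgClosed

theorem ddcl_le_aclField (D : Ω → Ω) (S : Set Ω) : ddcl Ω D S ≤ aclField D S := fun x hx =>
  (algebraicClosure (ddcl Ω D S) Ω).algebraMap_mem ⟨x, hx⟩

theorem subset_aclField (D : Ω → Ω) (S : Set Ω) : S ⊆ aclField D S :=
  (subset_ddcl D S).trans (ddcl_le_aclField D S)

theorem aclField_mono {D : Ω → Ω} {S T : Set Ω} (h : S ⊆ T) : aclField D S ≤ aclField D T :=
  fun _ hx => Subfield.isIntegral_mono (ddcl_mono h) hx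

/-- The algebraic closure of a differential subfield is closed under the derivation. -/
theorem apply_mem_aclField [CharZero Ω] (D : Derivation ℤ Ω Ω) (S : Set Ω) :
    ∀ x ∈ aclField (fun x => D x) S, D x ∈ aclField (fun x => D x) S := by
  intro x hx
  let k := ddcl Ω (fun x => D x) S
  let A := aclField (fun x => D x) S
  have hk : k ≤ A := ddcl_le_aclField _ S
  have hint : IsIntegral k x := hx
  let p := minpoly k x
  have haeval : ∀ q : Polynomial k, Polynomial.aeval x q ∈ A := fun q => by
    rw [Polynomial.aeval_eq_sum_range]
    exact sum_mem fun i _ => A.mul_mem (hk (q.coeff i).2) (pow_mem hx i)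
  have hsep : Polynomial.aeval x (Polynomial.derivative p) ≠ 0 :=
    (minpoly.irreducible hint).separable.aeval_derivative_ne_zero (minpoly.aeval k x)
  have hD : ∀ q : Polynomial k, D (Polynomial.aeval x q) -
      Polynomial.aeval x (Polynomial.derivative q) * D x ∈ A := by
    intro q
    induction q using Polynomial.induction_on' with
    | add q r hq hr =>
      simp only [map_add]
      convert A.add_mem hq hr using 1
      ring
    | monomial n a =>
      have : D (Polynomial.aeval x (Polynomial.monomial n a)) -
          Polynomial.aeval x (Polynomial.derivative (Polynomial.monomial n a)) * D x =
          x ^ n * D (a : Ω) := by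
        rw [Polynomial.derivative_monomial, Polynomial.aeval_monomial, Polynomial.aeval_monomial,
          Derivation.leibniz, Derivation.leibniz_pow]
        simp only [smul_eq_mul, nsmul_eq_mul, map_mul, map_natCast]
        change (a : Ω) * _ + x ^ n * D (a : Ω) - (a : Ω) * _ * _ * _ = _
        ring
      rw [this]
      exact A.mul_mem (pow_mem hx n) (hk (apply_mem_ddcl _ S _ a.2))
  have := A.mul_mem (hD p) (A.inv_mem (haeval (Polynomial.derivative p)))
  rw [minpoly.aeval, map_zero, zero_sub, neg_mul, mul_right_comm, mul_inv_cancel₀ hsep,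
    one_mul] at this
  exact neg_mem_iff.mp this

/-- By Leibniz's rule, the compositum of two differential subfields is a differential subfield. -/
theorem apply_mem_sup (D : Derivation ℤ Ω Ω) {K L : Subfield Ω} (hK : ∀ x ∈ K, D x ∈ K)
    (hL : ∀ x ∈ L, D x ∈ L) : ∀ x ∈ K ⊔ L, D x ∈ K ⊔ L := by
  intro x hx
  have hcl : K ⊔ L = Subfield.closure (K ∪ L) := by
    rw [Subfield.closure_union, Subfield.closure_eq, Subfield.closure_eq]
  rw [hcl] at hx
  refine (?_ : x ∈ K ⊔ L ∧ D x ∈ K ⊔ L).2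
  induction hx using Subfield.closure_induction with
  | mem x h =>
    rcases h with h | h
    · exact ⟨le_sup_left (a := K) h, le_sup_left (a := K) (hK x h)⟩
    · exact ⟨le_sup_right (a := K) h, le_sup_right (a := K) (hL x h)⟩
  | one => exact ⟨one_mem _, by simp⟩
  | add x y _ _ hx hy =>
    rw [map_add]
    exact ⟨add_mem hx.1 hy.1, add_mem hx.2 hy.2⟩
  | neg x _ hx =>
    rw [map_neg]
    exact ⟨neg_mem hx.1, neg_mem hx.2⟩
  | inv x _ hx =>
    rw [Derivation.leibniz_inv]
    exact ⟨inv_mem hx.1, mul_mem (neg_mem (pow_mem (inv_mem hx.1) 2)) hx.2⟩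
  | mul x y _ _ hx hy =>
    rw [Derivation.leibniz]
    exact ⟨mul_mem hx.1 hy.1, add_mem (mul_mem hx.1 hy.2) (mul_mem hy.1 hx.2)⟩

theorem ddcl_aclD_union [CharZero Ω] (D : Derivation ℤ Ω Ω) (S T : Set Ω) :
    ddcl Ω (fun x => D x) (aclD Ω (fun x => D x) S ∪ aclD Ω (fun x => D x) T) =
      aclField (fun x => D x) S ⊔ aclField (fun x => D x) T := by
  rw [← coe_aclField, ← coe_aclField]
  refine le_antisymm (ddcl_le (Set.union_subset ?_ ?_)
    (apply_mem_sup D (apply_mem_aclField D S) (apply_mem_aclField D T))) (sup_le ?_ ?_)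
  · exact le_sup_left (a := aclField (fun x => D x) S)
  · exact le_sup_right (a := aclField (fun x => D x) S)
  · exact Set.subset_union_left.trans (subset_ddcl _ _)
  · exact Set.subset_union_right.trans (subset_ddcl _ _)

/-- An element of `acl(S ∪ T)` is algebraic over the compositum of `acl(S)` and `acl(T)`. -/
theorem isIntegral_of_mem_aclField_union [CharZero Ω] (D : Derivation ℤ Ω Ω) {S T U : Set Ω}
    (hU : U ⊆ S ∪ T) {x : Ω} (hx : x ∈ aclField (fun x => D x) U) :
    IsIntegral ↥(aclField (fun x => D x) S ⊔ aclField (fun x => D x) T) x := by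
  refine Subfield.isIntegral_mono (ddcl_le (hU.trans (Set.union_subset ?_ ?_))
    (apply_mem_sup D (apply_mem_aclField D S) (apply_mem_aclField D T))) hx
  · exact (subset_aclField _ S).trans (le_sup_left (a := aclField (fun x => D x) S))
  · exact (subset_aclField _ T).trans (le_sup_right (a := aclField (fun x => D x) S))

theorem LinDisjOver.injective_productMap {E : Subfield Ω} {K L : IntermediateField E Ω}
    (h : LinDisjOver Ω E L K) :
    Function.Injective (Algebra.TensorProduct.productMap K.val L.val) := by
  classical
  let b := Module.Basis.ofVectorSpace E L
  have hdisj : K.toSubalgebra.LinearDisjoint L.toSubalgebra := by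
    refine Subalgebra.LinearDisjoint.of_basis_right _ _ b ?_
    rw [linearIndependent_iff']
    intro s c hc i hi
    let e := s.equivFin
    have hind : LinIndepOver Ω E fun j => (b (e.symm j) : Ω) := by
      intro d hd hsum j
      have hli : LinearIndependent E fun j => b (e.symm j) :=
        b.linearIndependent.comp (fun j => (e.symm j : _))
          (Subtype.val_injective.comp e.symm.injective)
      have := Fintype.linearIndependent_iff.mp hli (fun j => ⟨d j, hd j⟩)
        (Subtype.ext (by simpa [Subfield.smul_def] using hsum)) j
      exact congrArg Subtype.val this
    have := h _ _ (fun j => (b (e.symm j)).2) hind (fun j => (c (e.symm j) : Ω))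
      (fun j => (c (e.symm j)).2) (by
        rw [e.symm.sum_comp fun j : s => (c j : Ω) * (b j : Ω)]
        exact (Finset.sum_coe_sort s fun j => (c j : Ω) * (b j : Ω)).trans hc) (e ⟨i, hi⟩)
    simpa using this
  exact Subalgebra.linearDisjoint_iff_injective.mp hdisj

end PaperDCF

open PaperDCF in
/-- **Theorem 9.9: `DCF₀` has the boundary property `B(3)`.** Work inside (the field
reduct of) a monster model `(Ω, D)` of `DCF₀`, where `dcl` is the generated differential
field, `acl` is the field-theoretic algebraic closure of the generated differential
field, and independence in `DCF₀` is `ACF₀`-independence (linear disjointness) of the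
corresponding algebraic closures. For every set `A` and every `A`-independent set
`{a₀, a₁, a₂}`:
`dcl(acl(A a₀ a₂) ∪ acl(A a₁ a₂)) ∩ acl(A a₀ a₁) = dcl(acl(A a₀) ∪ acl(A a₁))`. -/
theorem DCF0_has_B3
    (Ω : Type) [Field Ω] [IsAlgClosed Ω] [CharZero Ω]
    (D : Derivation ℤ Ω Ω)
    (A : Set Ω) (a0 a1 a2 : Ω)
    (h0 : LinDisjOver Ω (aclD Ω (fun x => D x) A)
      (aclD Ω (fun x => D x) (A ∪ {a0})) (aclD Ω (fun x => D x) (A ∪ {a1, a2})))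
    (h1 : LinDisjOver Ω (aclD Ω (fun x => D x) A)
      (aclD Ω (fun x => D x) (A ∪ {a1})) (aclD Ω (fun x => D x) (A ∪ {a0, a2})))
    (h2 : LinDisjOver Ω (aclD Ω (fun x => D x) A)
      (aclD Ω (fun x => D x) (A ∪ {a2})) (aclD Ω (fun x => D x) (A ∪ {a0, a1}))) :
    (↑(ddcl Ω (fun x => D x)
          (aclD Ω (fun x => D x) (A ∪ {a0, a2}) ∪ aclD Ω (fun x => D x) (A ∪ {a1, a2})))
        ∩ aclD Ω (fun x => D x) (A ∪ {a0, a1}))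
      = ↑(ddcl Ω (fun x => D x)
          (aclD Ω (fun x => D x) (A ∪ {a0}) ∪ aclD Ω (fun x => D x) (A ∪ {a1}))) := by
  let E := aclField (fun x => D x) A
  let F : (S : Set Ω) → IntermediateField E Ω := fun S =>
    (aclField (fun x => D x) (A ∪ S)).toIntermediateField fun e =>
      aclField_mono Set.subset_union_left e.2
  have hmono : ∀ S T : Set Ω, S ⊆ T → F S ≤ F T := fun S T h =>
    aclField_mono (Set.union_subset_union_right A h)
  have hclosed : ∀ S, IsAlgClosed (F S).toSubfield := fun S =>
    inferInstanceAs (IsAlgClosed (aclField (fun x => D x) (A ∪ S)))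
  simp only [← coe_aclField] at h2
  have hKL : Function.Injective
      (Algebra.TensorProduct.productMap (F {a0, a1}).val (F {a2}).val) :=
    LinDisjOver.injective_productMap h2
  rw [ddcl_aclD_union, ddcl_aclD_union, ← coe_aclField]
  refine Set.Subset.antisymm ?_ (Set.subset_inter ?_ ?_)
  · rintro x ⟨hx, hxK⟩
    refine mem_sup_of_mem_sup_of_linearDisjoint (K₀ := F {a0}) (K₁ := F {a1})
      (hmono _ _ (by simp)) (hmono _ _ (by simp)) hKL (fun y hy => ?_) (fun y hy => ?_) hx hxK
    · exact isIntegral_of_mem_aclField_union D (by grind) hy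
    · exact isIntegral_of_mem_aclField_union D (by grind) hy
  · exact SetLike.coe_subset_coe.mpr
      (sup_le_sup (aclField_mono (by grind)) (aclField_mono (by grind)))
  · exact SetLike.coe_subset_coe.mpr
      (sup_le (aclField_mono (by grind)) (aclField_mono (by grind)))
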